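/- There exists a family of four line segments in the plane ℝ² that is shattered by halfplanes and in which exactly one unordered pair of distinct segments intersects (all other pairs are disjoint). -/

import Mathlib

open RealInnerProductSpace

/-- The Euclidean plane `ℝ²`. -/
abbrev Plane : Type := EuclideanSpace ℝ (Fin 2)

/-- A (closed) halfplane: `{x | ⟪a, x⟫ ≤ b}` for some nonzero `a` and real `b`. -/
def IsHalfplane (h : Set Plane) : Prop :=
  ∃ a : Plane, a ≠ 0 ∧ ∃ b : ℝ, h = {x : Plane | ⟪a, x⟫ ≤ b}

/-- A family of sets in the plane is shattered by halfplanes if every subfamily is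
realized by some halfplane. -/
def ShatteredByHalfplanes {ι : Type} (C : ι → Set Plane) : Prop :=
  ∀ T : Set ι, ∃ h : Set Plane, IsHalfplane h ∧ ∀ i : ι, C i ⊆ h ↔ i ∈ T

/-- A halfplane contains a segment iff it contains both endpoints. -/
theorem segment_subset_halfplane_iff (a p q : Plane) (b : ℝ) :
    segment ℝ p q ⊆ {x : Plane | ⟪a, x⟫ ≤ b} ↔
      a 0 * p 0 + a 1 * p 1 ≤ b ∧ a 0 * q 0 + a 1 * q 1 ≤ b := by
  have inner_eq (x : Plane) : ⟪a, x⟫ = a 0 * x 0 + a 1 * x 1 := by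
    simp [PiLp.inner_apply, Fin.sum_univ_two, mul_comm]
  have hconv : Convex ℝ {x : Plane | ⟪a, x⟫ ≤ b} :=
    convex_halfSpace_le (innerSL ℝ a).isLinear b
  rw [← inner_eq, ← inner_eq]
  exact ⟨fun h => ⟨h (left_mem_segment ℝ p q), h (right_mem_segment ℝ p q)⟩,
    fun h => hconv.segment_subset h.1 h.2⟩

/-- Two segments strictly separated by a linear functional are disjoint. -/
theorem not_nonempty_segment_inter_segment {p q r s : Plane} (u v b : ℝ)
    (hp : u * p 0 + v * p 1 ≤ b) (hq : u * q 0 + v * q 1 ≤ b)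
    (hr : b < u * r 0 + v * r 1) (hs : b < u * s 0 + v * s 1) :
    ¬ (segment ℝ p q ∩ segment ℝ r s).Nonempty := by
  rintro ⟨x, ⟨c, d, hc, hd, hcd, rfl⟩, e, f, he, hf, hef, hx⟩
  have h0 := congrArg (fun y : Plane => y 0) hx
  have h1 := congrArg (fun y : Plane => y 1) hx
  simp only [PiLp.add_apply, PiLp.smul_apply, smul_eq_mul] at h0 h1
  have hle : c * (u * p 0 + v * p 1) + d * (u * q 0 + v * q 1) ≤ b :=
    convex_Iic b hp hq hc hd hcd
  have hlt : b < e * (u * r 0 + v * r 1) + f * (u * s 0 + v * s 1) :=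
    convex_Ioi b hr hs he hf hef
  have heq : c * (u * p 0 + v * p 1) + d * (u * q 0 + v * q 1) =
      e * (u * r 0 + v * r 1) + f * (u * s 0 + v * s 1) := by
    linear_combination -u * h0 - v * h1
  linarith

/-- Four segments in the plane, of which only the second and the fourth intersect. -/
noncomputable def crossingSegments : Fin 4 → Plane × Plane :=
  ![(!₂[-5, 4], !₂[-2, 6]), (!₂[4, -1], !₂[-2, 5]), (!₂[-4, 1], !₂[-5, -3]),
    (!₂[6, 3], !₂[-3, 1])]

theorem shattered_crossingSegments :
    ShatteredByHalfplanes
      (fun i => segment ℝ (crossingSegments i).1 (crossingSegments i).2) := by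
  intro T
  suffices h : ∃ u v b : ℝ, (u ≠ 0 ∨ v ≠ 0) ∧ ∀ i,
      (u * (crossingSegments i).1 0 + v * (crossingSegments i).1 1 ≤ b ∧
        u * (crossingSegments i).2 0 + v * (crossingSegments i).2 1 ≤ b) ↔ i ∈ T by
    obtain ⟨u, v, b, huv, h⟩ := h
    refine ⟨_, ⟨!₂[u, v], fun h0 => ?_, b, rfl⟩, fun i => ?_⟩
    · have hu := congrArg (fun y : Plane => y 0) h0
      have hv := congrArg (fun y : Plane => y 1) h0
      simp at hu hv
      exact huv.elim (· hu) (· hv)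
    · rw [segment_subset_halfplane_iff]
      simpa using h i
  by_cases h0 : 0 ∈ T <;> by_cases h1 : 1 ∈ T <;> by_cases h2 : 2 ∈ T <;> by_cases h3 : 3 ∈ T
  · exact ⟨1, 0, 6, by norm_num, by simp [Fin.forall_fin_succ, crossingSegments, *]; try norm_num⟩
  · exact ⟨1, 0, 4, by norm_num, by simp [Fin.forall_fin_succ, crossingSegments, *]; try norm_num⟩
  · exact ⟨0, -1, 1, by norm_num, by simp [Fin.forall_fin_succ, crossingSegments, *]; try norm_num⟩
  · exact ⟨-1, -1, 1, by norm_num, by simp [Fin.forall_fin_succ, crossingSegments, *]; try norm_num⟩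
  · exact ⟨1, -1, 3, by norm_num, by simp [Fin.forall_fin_succ, crossingSegments, *]; try norm_num⟩
  · exact ⟨1, 0, -2, by norm_num, by simp [Fin.forall_fin_succ, crossingSegments, *]; try norm_num⟩
  · exact ⟨0, -1, -1, by norm_num, by simp [Fin.forall_fin_succ, crossingSegments, *]; try norm_num⟩
  · exact ⟨0, -1, -4, by norm_num, by simp [Fin.forall_fin_succ, crossingSegments, *]; try norm_num⟩
  · exact ⟨0, 1, 5, by norm_num, by simp [Fin.forall_fin_succ, crossingSegments, *]; try norm_num⟩
  · exact ⟨1, 1, 3, by norm_num, by simp [Fin.forall_fin_succ, crossingSegments, *]; try norm_num⟩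
  · exact ⟨-1, 0, 3, by norm_num, by simp [Fin.forall_fin_succ, crossingSegments, *]; try norm_num⟩
  · exact ⟨-1, 0, 2, by norm_num, by simp [Fin.forall_fin_succ, crossingSegments, *]; try norm_num⟩
  · exact ⟨0, 1, 3, by norm_num, by simp [Fin.forall_fin_succ, crossingSegments, *]; try norm_num⟩
  · exact ⟨0, 1, 1, by norm_num, by simp [Fin.forall_fin_succ, crossingSegments, *]; try norm_num⟩
  · exact ⟨-1, 1, 4, by norm_num, by simp [Fin.forall_fin_succ, crossingSegments, *]; try norm_num⟩
  · exact ⟨1, 0, -5, by norm_num, by simp [Fin.forall_fin_succ, crossingSegments, *]; try norm_num⟩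

theorem crossingSegments_inter_nonempty_iff {i j : Fin 4} (hij : i < j) :
    (segment ℝ (crossingSegments i).1 (crossingSegments i).2 ∩
      segment ℝ (crossingSegments j).1 (crossingSegments j).2).Nonempty ↔ i = 1 ∧ j = 3 := by
  have h01 := not_nonempty_segment_inter_segment (p := !₂[-5, 4]) (q := !₂[-2, 6])
    (r := !₂[4, -1]) (s := !₂[-2, 5]) 1 (-1) (-8) (by norm_num) (by norm_num) (by norm_num)
    (by norm_num)
  have h02 := not_nonempty_segment_inter_segment (p := !₂[-5, 4]) (q := !₂[-2, 6])
    (r := !₂[-4, 1]) (s := !₂[-5, -3]) 0 (-1) (-4) (by norm_num) (by norm_num) (by norm_num)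
    (by norm_num)
  have h03 := not_nonempty_segment_inter_segment (p := !₂[-5, 4]) (q := !₂[-2, 6])
    (r := !₂[6, 3]) (s := !₂[-3, 1]) 0 (-1) (-4) (by norm_num) (by norm_num) (by norm_num)
    (by norm_num)
  have h12 := not_nonempty_segment_inter_segment (p := !₂[4, -1]) (q := !₂[-2, 5])
    (r := !₂[-4, 1]) (s := !₂[-5, -3]) (-1) 0 2 (by norm_num) (by norm_num) (by norm_num)
    (by norm_num)
  have h23 := not_nonempty_segment_inter_segment (p := !₂[-4, 1]) (q := !₂[-5, -3])
    (r := !₂[6, 3]) (s := !₂[-3, 1]) 1 0 (-4) (by norm_num) (by norm_num) (by norm_num)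
    (by norm_num)
  have h13 : (segment ℝ (!₂[4, -1] : Plane) !₂[-2, 5] ∩
      segment ℝ (!₂[6, 3] : Plane) !₂[-3, 1]).Nonempty := by
    refine ⟨!₂[12 / 11, 21 / 11], ⟨17 / 33, 16 / 33, by norm_num, by norm_num, by norm_num, ?_⟩,
      ⟨5 / 11, 6 / 11, by norm_num, by norm_num, by norm_num, ?_⟩⟩ <;>
    · ext k
      fin_cases k <;> norm_num
  fin_cases i <;> fin_cases j <;> first | exact absurd hij (by decide) | simpa [crossingSegments]

/-- There is a shattered family of four segments in the plane with exactly one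
intersecting pair of distinct segments. -/
theorem four_segments_shattered_one_intersection :
    ∃ s : Fin 4 → Plane × Plane,
      ShatteredByHalfplanes (fun i => segment ℝ (s i).1 (s i).2) ∧
      Set.ncard {p : Fin 4 × Fin 4 | p.1 < p.2 ∧
        (segment ℝ (s p.1).1 (s p.1).2 ∩ segment ℝ (s p.2).1 (s p.2).2).Nonempty} = 1 := by
  refine ⟨crossingSegments, shattered_crossingSegments, Set.ncard_eq_one.2 ⟨(1, 3), ?_⟩⟩
  ext ⟨i, j⟩
  simp only [Set.mem_ofPred_eq, Set.mem_singleton_iff, Prod.mk.injEq]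
  constructor
  · rintro ⟨hij, h⟩
    exact (crossingSegments_inter_nonempty_iff hij).1 h
  · rintro ⟨rfl, rfl⟩
    exact ⟨by decide, (crossingSegments_inter_nonempty_iff (by decide)).2 ⟨rfl, rfl⟩⟩
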